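/- (Main theorem, competitiveness of the algorithm) Let σ be an ALG-schedule and σ_O any schedule of the same instance, assume 1/(1−α) is an integer, and assume that every job completes under both schedules (C_j < ∞ and C^O_j < ∞ for all j ∈ J). Then the total flow time of σ is at most (4 + 2/(1−α)) times that of σ_O; that is, ∑_{j∈J} (C_j − r j) ≤ (4 + 2/(1−α)) · ∑_{j∈J} (C^O_j − r j). -/

import Mathlib

open MeasureTheory Set

open scoped Classical

noncomputable section

variable {J : Type*}

/-- Total work done on job `j` by time `u` under the schedule `σ`. -/
def workDone (σ : ℝ → J → ℝ) (j : J) (u : ℝ) : ℝ := ∫ v in (0:ℝ)..u, σ v j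

/-- Remaining processing time of job `j` at time `u`. -/
def remT (p : J → ℝ) (σ : ℝ → J → ℝ) (j : J) (u : ℝ) : ℝ := p j - workDone σ j u

/-- Completion time of job `j`: the least `u` with `workDone σ j u = p j`,
    and `⊤` if the job never completes. -/
def cTime (p : J → ℝ) (σ : ℝ → J → ℝ) (j : J) : EReal :=
  sInf ((fun v : ℝ => (v : EReal)) '' {v : ℝ | workDone σ j v = p j})

/-- Job `j` is available at time `u`: released and not yet completed. -/
def availAt (r p : J → ℝ) (σ : ℝ → J → ℝ) (u : ℝ) (j : J) : Prop :=
  r j ≤ u ∧ (u : EReal) < cTime p σ j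

/-- Job `j` is processed at time `u`. -/
def procAt (σ : ℝ → J → ℝ) (u : ℝ) (j : J) : Prop := 0 < σ u j

/-- Job `j` is non-clairvoyant at time `u`. -/
def ncAt (r p : J → ℝ) (α : ℝ) (σ : ℝ → J → ℝ) (u : ℝ) (j : J) : Prop :=
  availAt r p σ u j ∧ workDone σ j u ≤ α * p j

/-- Job `j` is clairvoyant at time `u`. -/
def clAt (r p : J → ℝ) (α : ℝ) (σ : ℝ → J → ℝ) (u : ℝ) (j : J) : Prop :=
  availAt r p σ u j ∧ α * p j < workDone σ j u

/-- The time at which job `j` emits its signal: the least `u` with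
    `workDone σ j u = α * p j`. -/
def emitT (p : J → ℝ) (α : ℝ) (σ : ℝ → J → ℝ) (j : J) : ℝ :=
  sInf {u : ℝ | workDone σ j u = α * p j}

/-- Data of an instance: nonnegative release dates, positive processing times
    and `α ∈ (0,1)`. -/
structure IsInstance (r p : J → ℝ) (α : ℝ) : Prop where
  r_nonneg : ∀ j, 0 ≤ r j
  p_pos : ∀ j, 0 < p j
  alpha_mem : α ∈ Set.Ioo (0 : ℝ) 1

/-- `σ` is a (feasible, preemptive, single machine) schedule. -/
structure IsSchedule [Fintype J] (r p : J → ℝ) (σ : ℝ → J → ℝ) : Prop where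
  meas : ∀ j, Measurable fun u => σ u j
  nonneg : ∀ u j, 0 ≤ σ u j
  sum_le_one : ∀ u, ∑ j, σ u j ≤ 1
  zero_before_release : ∀ u j, u < r j → σ u j = 0
  workDone_le : ∀ u j, workDone σ j u ≤ p j

/-- A schedule is non-idling if it uses the full machine capacity whenever
    some job is available. -/
def NonIdling [Fintype J] (r p : J → ℝ) (σ : ℝ → J → ℝ) : Prop :=
  ∀ u, (∃ j, availAt r p σ u j) → ∑ j, σ u j = 1

/-- The SRPT condition at time `u`: `Cl(u) ≠ ∅` and
    `min_{j ∈ Cl(u)} p_j(u) ≤ ((1-α)/α) · min_{j ∈ N(u)} y_j(u)`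
    (the minimum over the empty set being `+∞`). -/
def SrptCond (r p : J → ℝ) (α : ℝ) (σ : ℝ → J → ℝ) (u : ℝ) : Prop :=
  ∃ k, clAt r p α σ u k ∧
    ∀ j, ncAt r p α σ u j → remT p σ k u ≤ ((1 - α) / α) * workDone σ j u

/-- `k` is a clairvoyant job of minimal remaining processing time at `u`,
    emitting last among those. -/
def IsSrptChoice (r p : J → ℝ) (α : ℝ) (σ : ℝ → J → ℝ) (u : ℝ) (k : J) : Prop :=
  clAt r p α σ u k ∧
    (∀ j, clAt r p α σ u j → remT p σ k u ≤ remT p σ j u) ∧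
    (∀ j, clAt r p α σ u j → remT p σ j u = remT p σ k u →
      emitT p α σ j ≤ emitT p α σ k)

/-- `j` is a non-clairvoyant job with minimal progress at time `u`. -/
def IsMinNc (r p : J → ℝ) (α : ℝ) (σ : ℝ → J → ℝ) (u : ℝ) (j : J) : Prop :=
  ncAt r p α σ u j ∧ ∀ j', ncAt r p α σ u j' → workDone σ j u ≤ workDone σ j' u

/-- `σ` is an ALG-schedule: non-idling, and at any time with available jobs it
    either runs a single clairvoyant job of shortest remaining processing time
    (breaking ties by latest emission) when the SRPT condition holds, or it runs
    exactly the non-clairvoyant jobs of minimal progress at equal rates. -/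
structure IsALG [Fintype J] (r p : J → ℝ) (α : ℝ) (σ : ℝ → J → ℝ) : Prop where
  sched : IsSchedule r p σ
  nonidling : NonIdling r p σ
  srpt_branch : ∀ u, (∃ j, availAt r p σ u j) → SrptCond r p α σ u →
    ∃ k, IsSrptChoice r p α σ u k ∧ ∀ j, j ≠ k → σ u j = 0
  setf_branch : ∀ u, (∃ j, availAt r p σ u j) → ¬ SrptCond r p α σ u →
    (∀ j, procAt σ u j → IsMinNc r p α σ u j) ∧
    (∀ j j', IsMinNc r p α σ u j → IsMinNc r p α σ u j' → σ u j = σ u j')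

/-- Right endpoint `min (C_j, t)` of the lifetime of `j` w.r.t. reference time `t`. -/
def lifeEnd (p : J → ℝ) (σ : ℝ → J → ℝ) (t : ℝ) (j : J) : ℝ :=
  (min (cTime p σ j) (t : EReal)).toReal

/-- The lifetime `I_j = [r j, min (C_j, t)]` of job `j`. -/
def lifetime (r p : J → ℝ) (σ : ℝ → J → ℝ) (t : ℝ) (j : J) : Set ℝ :=
  Set.Icc (r j) (lifeEnd p σ t j)

/-- `E_N`-edge of the borrow graph: `i` is processed at some time of `I_j`
    while being non-clairvoyant. -/
def ENedge (r p : J → ℝ) (α : ℝ) (σ : ℝ → J → ℝ) (t : ℝ) (j i : J) : Prop :=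
  ∃ u ∈ lifetime r p σ t j, procAt σ u i ∧ ncAt r p α σ u i

/-- `E_C`-edge of the borrow graph: `i` is processed at some time of `I_j`
    while being clairvoyant. -/
def ECedge (r p : J → ℝ) (α : ℝ) (σ : ℝ → J → ℝ) (t : ℝ) (j i : J) : Prop :=
  ∃ u ∈ lifetime r p σ t j, procAt σ u i ∧ clAt r p α σ u i

/-- Edge of the borrow graph `G_B`. -/
def borrowEdge (r p : J → ℝ) (α : ℝ) (σ : ℝ → J → ℝ) (t : ℝ) (j i : J) : Prop :=
  ENedge r p α σ t j i ∨ ECedge r p α σ t j i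

/-- `reaches j i` iff `i ∈ R_j`, i.e. `i` is reachable from `j` in the borrow
    graph (`j` itself included). -/
def reaches (r p : J → ℝ) (α : ℝ) (σ : ℝ → J → ℝ) (t : ℝ) : J → J → Prop :=
  Relation.ReflTransGen (borrowEdge r p α σ t)

/-- Truncated progress `ȳ_j = min (y_j(t), α p_j)`. -/
def truncY (p : J → ℝ) (α : ℝ) (σ : ℝ → J → ℝ) (t : ℝ) (j : J) : ℝ :=
  min (workDone σ j t) (α * p j)

end

namespace IsSchedule

variable {J : Type*} [Fintype J] {r p : J → ℝ} {σ : ℝ → J → ℝ}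

lemma le_one (h : IsSchedule r p σ) (u : ℝ) (j : J) : σ u j ≤ 1 :=
  (Finset.single_le_sum (f := fun i => σ u i) (fun i _ => h.nonneg u i)
    (Finset.mem_univ j)).trans (h.sum_le_one u)

lemma locallyIntegrable (h : IsSchedule r p σ) (j : J) :
    LocallyIntegrable (fun v => σ v j) volume := by
  refine (locallyIntegrable_const (1 : ℝ)).mono (h.meas j).aestronglyMeasurable ?_
  refine Filter.Eventually.of_forall fun v => ?_
  simpa [abs_of_nonneg (h.nonneg v j)] using h.le_one v j

lemma intervalIntegrable (h : IsSchedule r p σ) (j : J) (a b : ℝ) :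
    IntervalIntegrable (fun v => σ v j) volume a b :=
  intervalIntegrable_iff.2 <|
    (LocallyIntegrable.integrableOn_isCompact (h.locallyIntegrable j) isCompact_uIcc).mono_set
      uIoc_subset_uIcc

lemma workDone_sub (h : IsSchedule r p σ) (j : J) (a b : ℝ) :
    workDone σ j b - workDone σ j a = ∫ v in a..b, σ v j :=
  intervalIntegral.integral_interval_sub_left (h.intervalIntegrable j _ _)
    (h.intervalIntegrable j _ _)

lemma workDone_mono (h : IsSchedule r p σ) (j : J) : Monotone (workDone σ j) := by
  intro a b hab
  have h1 := h.workDone_sub j a b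
  have h2 : 0 ≤ ∫ v in a..b, σ v j :=
    intervalIntegral.integral_nonneg hab fun v _ => h.nonneg v j
  linarith

lemma workDone_continuous (h : IsSchedule r p σ) (j : J) : Continuous (workDone σ j) :=
  intervalIntegral.continuous_primitive (fun a b => h.intervalIntegrable j a b) 0

lemma workDone_eq_zero (h : IsSchedule r p σ) {j : J} {u : ℝ} (hr : 0 ≤ r j) (hu : u ≤ r j) :
    workDone σ j u = 0 := by
  refine intervalIntegral.integral_zero_ae ?_
  have h1 : ∀ᵐ x : ℝ, x ≠ r j := by simp [ae_iff, measure_singleton]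
  filter_upwards [h1] with x hx hxu
  refine h.zero_before_release x j (lt_of_le_of_ne ?_ hx)
  rcases mem_uIoc.1 hxu with h2 | h2
  · exact h2.2.trans hu
  · exact h2.2.trans hr

lemma workDone_nonneg (h : IsSchedule r p σ) {j : J} (hr : 0 ≤ r j) (u : ℝ) :
    0 ≤ workDone σ j u := by
  rcases le_total u (r j) with hu | hu
  · exact (h.workDone_eq_zero hr hu).ge
  · exact (h.workDone_eq_zero hr le_rfl).symm.le.trans (h.workDone_mono j hu)

lemma exists_proc (h : IsSchedule r p σ) {j : J} {a b : ℝ} (hab : a ≤ b)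
    (hw : workDone σ j a < workDone σ j b) : ∃ u ∈ Ioc a b, 0 < σ u j := by
  by_contra! hc
  have h1 := h.workDone_sub j a b
  have h2 : ∫ v in a..b, σ v j = 0 := by
    refine intervalIntegral.integral_zero_ae (Filter.Eventually.of_forall fun x hx => ?_)
    rw [uIoc_of_le hab] at hx
    exact le_antisymm (hc x hx) (h.nonneg x j)
  linarith

lemma sum_work_eq (h : IsSchedule r p σ) (s : Finset J) (a b : ℝ) :
    ∑ j ∈ s, (workDone σ j b - workDone σ j a) = ∫ v in a..b, ∑ j ∈ s, σ v j := by
  rw [intervalIntegral.integral_finsetSum fun j _ => h.intervalIntegrable j a b]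
  exact Finset.sum_congr rfl fun j _ => h.workDone_sub j a b

lemma sum_work_le (h : IsSchedule r p σ) (s : Finset J) {a b : ℝ} (hab : a ≤ b) :
    ∑ j ∈ s, (workDone σ j b - workDone σ j a) ≤ b - a := by
  rw [h.sum_work_eq]
  calc ∫ v in a..b, ∑ j ∈ s, σ v j ≤ ∫ _ in a..b, (1 : ℝ) := by
        refine intervalIntegral.integral_mono_on hab ?_ (by simp) fun v _ => ?_
        · simpa only [Finset.sum_fn] using
            IntervalIntegrable.sum s fun j _ => h.intervalIntegrable j a b
        · exact (Finset.sum_le_sum_of_subset_of_nonneg (Finset.subset_univ s)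
            fun i _ _ => h.nonneg v i).trans (h.sum_le_one v)
    _ = b - a := by simp

lemma sum_work_of_busy (h : IsSchedule r p σ) {a b : ℝ} (hab : a ≤ b)
    (hbusy : ∀ u ∈ Ioc a b, ∑ j, σ u j = 1) :
    ∑ j, (workDone σ j b - workDone σ j a) = b - a := by
  rw [h.sum_work_eq]
  calc ∫ v in a..b, ∑ j, σ v j = ∫ _ in a..b, (1 : ℝ) := by
        refine intervalIntegral.integral_congr_ae (Filter.Eventually.of_forall fun x hx => ?_)
        rw [uIoc_of_le hab] at hx
        exact hbusy x hx
    _ = b - a := by simp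

/-- The progress of a job cannot enter an interval of values at which it is never processed. -/
lemma workDone_le_of_gap (h : IsSchedule r p σ) {j : J} {s t a b : ℝ} (hst : s ≤ t)
    (hs : workDone σ j s ≤ a) (hab : a < b)
    (hgap : ∀ u ∈ Ioc s t, a < workDone σ j u → workDone σ j u < b → ¬ 0 < σ u j) :
    workDone σ j t ≤ a := by
  by_contra! hta
  obtain ⟨w, hw, hwa⟩ : ∃ w ∈ Icc s t, workDone σ j w = a :=
    intermediate_value_Icc hst (h.workDone_continuous j).continuousOn ⟨hs, hta.le⟩
  obtain ⟨c, hac, hc⟩ := exists_between (lt_min hta hab)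
  obtain ⟨v, hv, hvc⟩ : ∃ v ∈ Icc w t, workDone σ j v = c :=
    intermediate_value_Icc hw.2 (h.workDone_continuous j).continuousOn
      ⟨hwa ▸ hac.le, hc.le.trans (min_le_left _ _)⟩
  -- the last time in `[w, v]` at which the progress is still `a`
  have hcl : IsCompact (Icc w v ∩ workDone σ j ⁻¹' {a}) :=
    isCompact_Icc.inter_right (isClosed_singleton.preimage (h.workDone_continuous j))
  obtain ⟨m, ⟨⟨hm, hma⟩, hmax⟩⟩ := hcl.exists_isGreatest ⟨w, left_mem_Icc.2 hv.1, hwa⟩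
  have hma : workDone σ j m = a := hma
  obtain ⟨x, hx, hx0⟩ := h.exists_proc (j := j) hm.2 (by rw [hma, hvc]; exact hac)
  refine hgap x ⟨(hw.1.trans hm.1).trans_lt hx.1, hx.2.trans hv.2⟩ ?_ ?_ hx0
  · refine lt_of_le_of_ne (hma ▸ h.workDone_mono j hx.1.le) fun he => ?_
    exact absurd (hmax ⟨⟨hm.1.trans hx.1.le, hx.2⟩, he.symm⟩) (not_le.2 hx.1)
  · exact ((h.workDone_mono j hx.2).trans_eq hvc).trans_lt (hc.trans_le (min_le_right _ _))

lemma lt_cTime_iff (h : IsSchedule r p σ) (j : J) (u : ℝ) :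
    (u : EReal) < cTime p σ j ↔ workDone σ j u < p j := by
  constructor
  · intro hu
    refine lt_of_le_of_ne (h.workDone_le u j) fun he => ?_
    exact absurd (show cTime p σ j ≤ u from sInf_le ⟨u, he, rfl⟩) (not_le.2 hu)
  · intro hu
    obtain ⟨v, hv, huv⟩ : ∃ v, workDone σ j v < p j ∧ u < v := by
      have h1 : ∀ᶠ v in nhds u, workDone σ j v < p j :=
        (h.workDone_continuous j).continuousAt.eventually_lt continuousAt_const hu
      exact ((h1.filter_mono nhdsWithin_le_nhds).and
        (self_mem_nhdsWithin : Ioi u ∈ nhdsWithin u (Ioi u))).exists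
    refine (EReal.coe_lt_coe_iff.2 huv).trans_le (le_sInf ?_)
    rintro _ ⟨x, hx, rfl⟩
    refine EReal.coe_le_coe_iff.2 (le_of_not_gt fun hxv => ?_)
    have h2 := h.workDone_mono j hxv.le
    have hx : workDone σ j x = p j := hx
    linarith

lemma availAt_iff (h : IsSchedule r p σ) (u : ℝ) (j : J) :
    availAt r p σ u j ↔ r j ≤ u ∧ workDone σ j u < p j := by
  rw [availAt, h.lt_cTime_iff]

lemma lt_toReal_cTime_iff (h : IsSchedule r p σ) {j : J} (hr : 0 ≤ r j) (hp : 0 < p j)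
    (hC : cTime p σ j ≠ ⊤) (u : ℝ) :
    u < (cTime p σ j).toReal ↔ workDone σ j u < p j := by
  have hb : cTime p σ j ≠ ⊥ := by
    have h1 : ((r j : ℝ) : EReal) < cTime p σ j :=
      (h.lt_cTime_iff j _).2 (by rw [h.workDone_eq_zero hr le_rfl]; exact hp)
    exact (bot_le.trans_lt h1).ne'
  rw [← h.lt_cTime_iff]
  conv_rhs => rw [← EReal.coe_toReal hC hb]
  exact EReal.coe_lt_coe_iff.symm

/-- If two jobs have equal remaining work on an interval and are never processed
simultaneously there, neither of them is worked on. -/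
lemma workDone_eq_of_tie (h : IsSchedule r p σ) {i k : J} {a b P : ℝ} (hab : a ≤ b)
    (htie : ∀ u ∈ Ioo a b, workDone σ i u - workDone σ k u = P)
    (hex : ∀ u ∈ Ioo a b, 0 < σ u i → σ u k = 0) :
    workDone σ i b = workDone σ i a := by
  have h1 := h.workDone_sub i a b
  suffices h2 : ∫ v in a..b, σ v i = 0 by linarith
  refine intervalIntegral.integral_zero_ae ?_
  have hne : ∀ᵐ x : ℝ, x ≠ b := by simp [ae_iff, measure_singleton]
  filter_upwards [LocallyIntegrable.ae_hasDerivAt_integral (h.locallyIntegrable i),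
    LocallyIntegrable.ae_hasDerivAt_integral (h.locallyIntegrable k), hne] with x hi hk hxb hx
  rw [uIoc_of_le hab] at hx
  have hx' : x ∈ Ioo a b := ⟨hx.1, lt_of_le_of_ne hx.2 hxb⟩
  have hd : HasDerivAt (fun u => workDone σ i u - workDone σ k u) (σ x i - σ x k) x :=
    (hi 0).sub (hk 0)
  have hc : HasDerivAt (fun u => workDone σ i u - workDone σ k u) 0 x := by
    refine (hasDerivAt_const x P).congr_of_eventuallyEq ?_
    filter_upwards [Ioo_mem_nhds hx'.1 hx'.2] with u hu
    exact htie u hu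
  have he := hd.unique hc
  by_contra hne0
  have hpos := lt_of_le_of_ne (h.nonneg x i) (Ne.symm hne0)
  have := hex x hx' hpos
  linarith

end IsSchedule

lemma integral_card_filter_le {J : Type*} {S : Finset J} {z : J → ℝ} {Z : ℝ}
    (hz : ∀ u ∈ S, z u ∈ Icc 0 Z) :
    IntervalIntegrable (fun x : ℝ => ((S.filter fun u => x ≤ z u).card : ℝ)) volume 0 Z ∧
      ∫ x in (0 : ℝ)..Z, ((S.filter fun u => x ≤ z u).card : ℝ) = ∑ u ∈ S, z u := by
  have hfun : (fun x : ℝ => ((S.filter fun u => x ≤ z u).card : ℝ)) =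
      fun x => ∑ u ∈ S, indicator {x | x ≤ z u} (fun _ => (1 : ℝ)) x := by
    funext x
    rw [Finset.card_filter]
    push_cast
    exact Finset.sum_congr rfl fun u _ => by simp [indicator_apply]
  have hint : ∀ u ∈ S, IntervalIntegrable
      (fun x => indicator {x | x ≤ z u} (fun _ => (1 : ℝ)) x) volume 0 Z := by
    intro u _
    refine intervalIntegrable_iff.2 (IntegrableOn.indicator ?_ measurableSet_Iic)
    simp
  rw [hfun]
  refine ⟨by simpa only [Finset.sum_fn] using IntervalIntegrable.sum S hint, ?_⟩
  rw [intervalIntegral.integral_finsetSum hint]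
  refine Finset.sum_congr rfl fun u hu => ?_
  rw [intervalIntegral.integral_indicator (hz u hu)]
  simp

lemma add_sum_le_sum_of_card {J : Type*} {S T : Finset J} {z w : J → ℝ} {Z : ℝ} {n : ℕ}
    (hZ : 0 ≤ Z) (hz : ∀ u ∈ S, z u ∈ Icc 0 Z) (hw : ∀ i ∈ T, w i ∈ Icc 0 Z)
    (hc : ∀ x ∈ Ioo 0 Z,
      n * (T.filter fun i => x ≤ w i).card + 1 ≤ (S.filter fun u => x ≤ z u).card) :
    Z + n * ∑ i ∈ T, w i ≤ ∑ u ∈ S, z u := by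
  obtain ⟨hS, hS'⟩ := integral_card_filter_le hz
  obtain ⟨hT, hT'⟩ := integral_card_filter_le hw
  have h1 := intervalIntegral.integral_mono_on_of_le_Ioo hZ
    ((hT.const_mul (n : ℝ)).add (intervalIntegrable_const (c := (1 : ℝ)))) hS
    (fun x hx => by
      have := hc x hx
      exact_mod_cast this)
  rw [intervalIntegral.integral_add (hT.const_mul _) intervalIntegrable_const,
    intervalIntegral.integral_const_mul, hS', hT'] at h1
  simp only [intervalIntegral.integral_const, sub_zero, smul_eq_mul, mul_one] at h1
  linarith

/-- If at each level `x` the total size of the members of `A` of key below `x` is covered by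
`x` plus the volume of the members of `D` of volume at most `n x`, then `A` has at most
`n |D| + 1` elements. -/
lemma card_le_of_volume_le {J : Type*} {A D : Finset J} {z q y : J → ℝ} {n : ℕ} (hn : 0 < n)
    (hz : ∀ u ∈ A, 0 ≤ z u) (hzq : ∀ u ∈ A, z u ≤ q u) (hq : ∀ u ∈ A, 0 < q u)
    (hy : ∀ i ∈ D, 0 ≤ y i)
    (H : ∀ x, 0 < x → ∑ u ∈ A.filter (fun u => z u < x), q u ≤
      x + ∑ i ∈ D.filter (fun i => y i ≤ n * x), y i) :
    A.card ≤ n * D.card + 1 := by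
  by_contra! hcon
  have hn' : (0 : ℝ) < n := by exact_mod_cast hn
  set bad := A.filter fun u => n * (D.filter fun i => y i ≤ n * z u).card + 2 ≤
    (A.filter fun w => z w ≤ z u).card with hbad
  have hne : bad.Nonempty := by
    have hA : A.Nonempty := Finset.card_pos.1 (by omega)
    obtain ⟨u, hu, hmax⟩ := A.exists_max_image z hA
    refine ⟨u, Finset.mem_filter.2 ⟨hu, ?_⟩⟩
    rw [Finset.filter_true_of_mem hmax]
    have := Nat.mul_le_mul_left n (Finset.card_filter_le D fun i => y i ≤ n * z u)
    omega
  obtain ⟨v, hv, hvmin⟩ := bad.exists_min_image z hne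
  obtain ⟨hvA, hvbad⟩ := Finset.mem_filter.1 hv
  set Z := z v with hZ
  have hZ0 : 0 ≤ Z := hz v hvA
  set S := A.filter fun w => z w ≤ Z with hS
  set T := D.filter fun i => y i ≤ n * Z with hT
  have hlim : ∑ u ∈ S, q u ≤ Z + ∑ i ∈ T, y i := by
    have hA : ∀ᶠ x in nhdsWithin Z (Ioi Z), ∀ u ∈ A, (z u < x ↔ z u ≤ Z) := by
      refine (Finset.eventually_all A).2 fun u _ => ?_
      rcases le_or_gt (z u) Z with h | h
      · filter_upwards [self_mem_nhdsWithin] with x hx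
        exact ⟨fun _ => h, fun _ => h.trans_lt hx⟩
      · filter_upwards [nhdsWithin_le_nhds (Iio_mem_nhds h)] with x hx
        exact ⟨fun h' => absurd hx h'.le.not_gt, fun h' => absurd h h'.not_gt⟩
    have hD : ∀ᶠ x in nhdsWithin Z (Ioi Z), ∀ i ∈ D, (y i ≤ n * x ↔ y i ≤ n * Z) := by
      refine (Finset.eventually_all D).2 fun i _ => ?_
      rcases le_or_gt (y i) (n * Z) with h | h
      · filter_upwards [self_mem_nhdsWithin] with x hx
        exact ⟨fun _ => h, fun _ => h.trans (mul_le_mul_of_nonneg_left (le_of_lt hx) hn'.le)⟩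
      · have h2 : Z < y i / n := by rwa [lt_div_iff₀ hn', mul_comm]
        filter_upwards [nhdsWithin_le_nhds (Iio_mem_nhds h2)] with x hx
        have hx : x < y i / n := hx
        rw [lt_div_iff₀ hn', mul_comm] at hx
        exact ⟨fun h' => absurd hx h'.not_gt, fun h' => absurd h h'.not_gt⟩
    have hev : ∀ᶠ x in nhdsWithin Z (Ioi Z), ∑ u ∈ S, q u ≤ x + ∑ i ∈ T, y i := by
      filter_upwards [hA, hD, self_mem_nhdsWithin] with x h1 h2 hx
      have := H x (hZ0.trans_lt hx)
      rwa [Finset.filter_congr h1, Finset.filter_congr h2] at this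
    refine ge_of_tendsto ?_ hev
    exact ((continuous_id.add continuous_const).tendsto Z).mono_left nhdsWithin_le_nhds
  have hvS : v ∈ S := Finset.mem_filter.2 ⟨hvA, le_rfl⟩
  obtain ⟨w, hwS, hwmin⟩ := S.exists_min_image z ⟨v, hvS⟩
  have hSA : S ⊆ A := Finset.filter_subset _ _
  have hsum : Z + n * ∑ i ∈ T, y i / n ≤ ∑ u ∈ S.erase w, z u := by
    refine add_sum_le_sum_of_card hZ0 (fun u hu => ?_) (fun i hi => ?_) fun x hx => ?_
    · obtain ⟨h1, h2⟩ := Finset.mem_filter.1 (Finset.mem_of_mem_erase hu)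
      exact ⟨hz u h1, h2⟩
    · obtain ⟨h1, h2⟩ := Finset.mem_filter.1 hi
      exact ⟨div_nonneg (hy i h1) hn'.le, by rwa [div_le_iff₀ hn', mul_comm]⟩
    · have hTc := Finset.card_filter_add_card_filter_not (s := T) fun i => x ≤ y i / n
      have hSc := Finset.card_filter_add_card_filter_not (s := S) fun u => x ≤ z u
      rcases le_or_gt x (z w) with hxw | hxw
      · rw [Finset.filter_true_of_mem fun u hu =>
          hxw.trans (hwmin u (Finset.mem_of_mem_erase hu)), Finset.card_erase_of_mem hwS]
        have := Nat.mul_le_mul_left n (Finset.card_filter_le T fun i => x ≤ y i / n)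
        omega
      · rw [Finset.filter_erase, Finset.erase_eq_of_notMem (by simp [hxw])]
        -- the largest key below `x` is not bad
        obtain ⟨u, hu, humax⟩ := (S.filter fun u => ¬ x ≤ z u).exists_max_image z
          ⟨w, Finset.mem_filter.2 ⟨hwS, hxw.not_ge⟩⟩
        obtain ⟨huS, hux⟩ := Finset.mem_filter.1 hu
        have hux : z u < x := not_le.1 hux
        have hub : u ∉ bad := fun h => absurd (hvmin u h) (hux.trans hx.2).not_ge
        have hub' : (A.filter fun w => z w ≤ z u).card ≤
            n * (D.filter fun i => y i ≤ n * z u).card + 1 := by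
          by_contra! h
          exact hub (Finset.mem_filter.2 ⟨hSA huS, h⟩)
        have h1 : (S.filter fun u => ¬ x ≤ z u).card ≤ (A.filter fun w => z w ≤ z u).card := by
          refine Finset.card_le_card fun a ha => ?_
          exact Finset.mem_filter.2
            ⟨hSA (Finset.mem_filter.1 ha).1, humax a ha⟩
        have h2 : (D.filter fun i => y i ≤ n * z u).card ≤
            (T.filter fun i => ¬ x ≤ y i / n).card := by
          refine Finset.card_le_card fun i hi => ?_
          obtain ⟨hiD, hi⟩ := Finset.mem_filter.1 hi
          refine Finset.mem_filter.2 ⟨Finset.mem_filter.2 ⟨hiD, hi.trans ?_⟩, ?_⟩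
          · exact mul_le_mul_of_nonneg_left (hux.trans hx.2).le hn'.le
          · rw [not_le, div_lt_iff₀ hn', mul_comm]
            exact hi.trans_lt (mul_lt_mul_of_pos_left hux hn')
        have h3 := Nat.mul_le_mul_left n h2
        have h4 : n * (T.filter fun i => x ≤ y i / n).card +
            n * (T.filter fun i => ¬ x ≤ y i / n).card = n * T.card := by
          rw [← Nat.mul_add, hTc]
        omega
  have hscale : n * ∑ i ∈ T, y i / n = ∑ i ∈ T, y i := by
    rw [← Finset.sum_div, mul_div_cancel₀ _ hn'.ne']
  have h5 : ∑ u ∈ S.erase w, z u ≤ ∑ u ∈ S.erase w, q u :=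
    Finset.sum_le_sum fun u hu => hzq u (hSA (Finset.mem_of_mem_erase hu))
  have h6 := Finset.add_sum_erase S q hwS
  have h7 := hq w (hSA hwS)
  linarith

namespace IsSchedule

variable {J : Type*} [Fintype J] {r p : J → ℝ} {σ : ℝ → J → ℝ}

lemma workDone_eq_of_remT_lt (h : IsSchedule r p σ) {i k : J} {a b : ℝ} (hab : a ≤ b)
    (hlt : remT p σ i a < remT p σ k a)
    (hk : ∀ u ∈ Ioc a b, 0 < σ u k → remT p σ k u ≤ remT p σ i u) :
    workDone σ k b = workDone σ k a := by
  refine le_antisymm ?_ (h.workDone_mono k hab)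
  refine h.workDone_le_of_gap (b := workDone σ k a + (remT p σ k a - remT p σ i a)) hab le_rfl
    (by linarith) fun u hu _ h2 hpos => ?_
  have h3 := hk u hu hpos
  have h4 := h.workDone_mono i hu.1.le
  simp only [remT] at *
  linarith

lemma remT_lt_of_remT_lt (h : IsSchedule r p σ) {i k : J} {a b : ℝ} (hab : a ≤ b)
    (hlt : remT p σ i a < remT p σ k a)
    (hk : ∀ u ∈ Ioc a b, 0 < σ u k → remT p σ k u ≤ remT p σ i u) :
    remT p σ i b < remT p σ k b := by
  have h1 := h.workDone_eq_of_remT_lt hab hlt hk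
  have h2 := h.workDone_mono i hab
  simp only [remT] at *
  linarith

/-- Two jobs that are processed by the shortest-remaining-time rule,
never simultaneously, cannot both progress immediately after `a`. -/
lemma workDone_eq_or_eq_of_tie (h : IsSchedule r p σ) {i k : J} {a b : ℝ} (hab : a < b)
    (hi : ∀ u ∈ Ioc a b, 0 < σ u i → remT p σ i u ≤ remT p σ k u)
    (hk : ∀ u ∈ Ioc a b, 0 < σ u k → remT p σ k u ≤ remT p σ i u)
    (hex : ∀ u ∈ Ioc a b, 0 < σ u i → σ u k = 0) :
    (∃ u ∈ Ioc a b, workDone σ i u = workDone σ i a) ∨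
      ∃ u ∈ Ioc a b, workDone σ k u = workDone σ k a := by
  have key : ∀ i k : J, (∀ u ∈ Ioc a b, 0 < σ u i → remT p σ i u ≤ remT p σ k u) →
      (∀ u ∈ Ioc a b, 0 < σ u k → remT p σ k u ≤ remT p σ i u) →
      (∀ w ∈ Ioc a b, ∃ u ∈ Icc a w, remT p σ i u ≠ remT p σ k u) →
      remT p σ i b < remT p σ k b → workDone σ k b = workDone σ k a := by
    intro i k hi hk hsep hb
    by_contra hne
    obtain ⟨u, hu, hpos⟩ := h.exists_proc hab.le
      (lt_of_le_of_ne (h.workDone_mono k hab.le) (Ne.symm hne))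
    obtain ⟨v, hv, hvne⟩ := hsep u hu
    rcases lt_or_gt_of_ne hvne with h1 | h1
    · have := h.remT_lt_of_remT_lt hv.2 h1
        fun w hw => hk w ⟨hv.1.trans_lt hw.1, hw.2.trans hu.2⟩
      exact absurd (hk u hu hpos) this.not_ge
    · have := h.remT_lt_of_remT_lt (hv.2.trans hu.2) h1
        fun w hw => hi w ⟨hv.1.trans_lt hw.1, hw.2⟩
      exact absurd hb this.not_gt
  by_cases htie : ∃ w ∈ Ioc a b, ∀ u ∈ Icc a w, remT p σ i u = remT p σ k u
  · obtain ⟨w, hw, hwt⟩ := htie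
    refine Or.inl ⟨w, hw, ?_⟩
    refine h.workDone_eq_of_tie (k := k) (P := p i - p k) hw.1.le (fun u hu => ?_)
      fun u hu => hex u ⟨hu.1, hu.2.le.trans hw.2⟩
    have := hwt u ⟨hu.1.le, hu.2.le⟩
    simp only [remT] at this
    linarith
  · push Not at htie
    have hbb : b ∈ Ioc a b := ⟨hab, le_rfl⟩
    rcases lt_trichotomy (remT p σ i b) (remT p σ k b) with h1 | h1 | h1
    · exact Or.inr ⟨b, hbb, key i k hi hk htie h1⟩
    · obtain ⟨v, hv, hvne⟩ := htie b hbb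
      rcases lt_or_gt_of_ne hvne with h2 | h2
      · exact absurd h1 (h.remT_lt_of_remT_lt hv.2 h2
          fun w hw => hk w ⟨hv.1.trans_lt hw.1, hw.2⟩).ne
      · exact absurd h1 (h.remT_lt_of_remT_lt hv.2 h2
          fun w hw => hi w ⟨hv.1.trans_lt hw.1, hw.2⟩).ne'
    · exact Or.inl ⟨b, hbb, key k i hk hi
        (fun w hw => (htie w hw).imp fun u hu => ⟨hu.1, hu.2.symm⟩) h1⟩

end IsSchedule

/-- The least remaining processing time of job `j` at time `u` that is consistent with what the
algorithm knows: it assumes that a job that has not emitted yet emits right now. -/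
noncomputable def optRem {J : Type*} (p : J → ℝ) (α : ℝ) (σ : ℝ → J → ℝ) (j : J) (u : ℝ) : ℝ :=
  min ((1 - α) / α * workDone σ j u) (remT p σ j u)

section OptRem

variable {J : Type*} {r p : J → ℝ} {α : ℝ} {σ : ℝ → J → ℝ}

lemma optRem_le_remT (j : J) (u : ℝ) : optRem p α σ j u ≤ remT p σ j u := min_le_right _ _

lemma optRem_of_le (hα : α ∈ Ioo (0 : ℝ) 1) {j : J} {u : ℝ} (hj : workDone σ j u ≤ α * p j) :
    optRem p α σ j u = (1 - α) / α * workDone σ j u := by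
  have h0 := hα.1
  refine min_eq_left ?_
  rw [div_mul_eq_mul_div, div_le_iff₀ h0, remT]
  linarith

lemma optRem_of_ge (hα : α ∈ Ioo (0 : ℝ) 1) {j : J} {u : ℝ} (hj : α * p j ≤ workDone σ j u) :
    optRem p α σ j u = remT p σ j u := by
  have h0 := hα.1
  refine min_eq_right ?_
  rw [div_mul_eq_mul_div, le_div_iff₀ h0, remT]
  linarith

lemma le_optRem_iff (hα : α ∈ Ioo (0 : ℝ) 1) {j : J} {u x : ℝ} :
    x ≤ optRem p α σ j u ↔
      α * x / (1 - α) ≤ workDone σ j u ∧ workDone σ j u ≤ p j - x := by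
  have h0 := hα.1
  have h1 : 0 < 1 - α := by linarith [hα.2]
  rw [optRem, le_min_iff, remT, div_mul_eq_mul_div, le_div_iff₀ h0, div_le_iff₀ h1]
  constructor <;> rintro ⟨h2, h3⟩ <;> constructor <;> linarith

lemma IsSchedule.optRem_continuous [Fintype J] (h : IsSchedule r p σ) (j : J) :
    Continuous (optRem p α σ j) :=
  (continuous_const.mul (h.workDone_continuous j)).min
    (continuous_const.sub (h.workDone_continuous j))

end OptRem

namespace IsALG

variable {J : Type*} [Fintype J] {r p : J → ℝ} {α : ℝ} {σ : ℝ → J → ℝ}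

lemma of_proc (h : IsALG r p α σ) (hinst : IsInstance r p α) {u : ℝ} {j : J}
    (hav : ∃ i, availAt r p σ u i) (hj : 0 < σ u j) :
    (∀ i, availAt r p σ u i → optRem p α σ j u ≤ optRem p α σ i u) ∧
      (α * p j < workDone σ j u → ∀ i, i ≠ j → σ u i = 0) := by
  have hβ : 0 < (1 - α) / α := div_pos (by linarith [hinst.alpha_mem.2]) hinst.alpha_mem.1
  by_cases hc : SrptCond r p α σ u
  · obtain ⟨k, ⟨_, hk2, -⟩, hk0⟩ := h.srpt_branch u hav hc
    obtain rfl : j = k := by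
      by_contra hne
      exact hj.ne' (hk0 j hne)
    refine ⟨fun i hi => (optRem_le_remT j u).trans ?_, fun _ => hk0⟩
    rcases le_or_gt (workDone σ i u) (α * p i) with hi' | hi'
    · obtain ⟨k, hk, hk'⟩ := hc
      rw [optRem_of_le hinst.alpha_mem hi']
      exact (hk2 k hk).trans (hk' i ⟨hi, hi'⟩)
    · rw [optRem_of_ge hinst.alpha_mem hi'.le]
      exact hk2 i ⟨hi, hi'⟩
  · obtain ⟨⟨_, hj1⟩, hj2⟩ := (h.setf_branch u hav hc).1 j hj
    refine ⟨fun i hi => ?_, fun hlt => absurd hj1 hlt.not_ge⟩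
    rw [optRem_of_le hinst.alpha_mem hj1]
    rcases le_or_gt (workDone σ i u) (α * p i) with hi' | hi'
    · rw [optRem_of_le hinst.alpha_mem hi']
      exact mul_le_mul_of_nonneg_left (hj2 i ⟨hi, hi'⟩) hβ.le
    · rw [optRem_of_ge hinst.alpha_mem hi'.le]
      simp only [SrptCond] at hc
      push Not at hc
      obtain ⟨l, hl, hl'⟩ := hc i ⟨hi, hi'⟩
      exact (mul_le_mul_of_nonneg_left (hj2 l hl) hβ.le).trans hl'.le

end IsALG

/-- `s` is the last time in `[0, t]` at which every incomplete job released before it has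
optimistic remaining time at least `x`. -/
structure IsLevelStart {J : Type*} (r p : J → ℝ) (α : ℝ) (σ : ℝ → J → ℝ) (t x s : ℝ) :
    Prop where
  mem : s ∈ Icc 0 t
  le_optRem : ∀ i, r i < s → workDone σ i s < p i → x ≤ optRem p α σ i s
  exists_lt : ∀ u ∈ Ioc s t, ∃ i, r i < u ∧ workDone σ i u < p i ∧ optRem p α σ i u < x

lemma IsSchedule.exists_isLevelStart {J : Type*} [Fintype J] {r p : J → ℝ} {α : ℝ}
    {σ : ℝ → J → ℝ} (h : IsSchedule r p σ) (hr : ∀ j, 0 ≤ r j) {t : ℝ} (ht : 0 ≤ t) (x : ℝ) :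
    ∃ s, IsLevelStart r p α σ t x s := by
  set G : Set ℝ := ⋂ i, (Iic (r i) ∪ {u | p i ≤ workDone σ i u}) ∪
    {u | x ≤ optRem p α σ i u} with hG
  have hmem : ∀ u, u ∈ G ↔ ∀ i, r i < u → workDone σ i u < p i → x ≤ optRem p α σ i u := by
    intro u
    simp only [hG, mem_iInter, mem_union, mem_Iic, mem_ofPred_eq]
    refine forall_congr' fun i => ?_
    rw [← not_lt (a := r i), ← not_lt (b := p i)]
    tauto
  have hcl : IsClosed G := isClosed_iInter fun i =>
    (isClosed_Iic.union (isClosed_le continuous_const (h.workDone_continuous i))).union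
      (isClosed_le continuous_const (h.optRem_continuous i))
  obtain ⟨s, ⟨hs, hsG⟩, hmax⟩ := (isCompact_Icc.inter_right hcl).exists_isGreatest
    (⟨0, left_mem_Icc.2 ht, (hmem 0).2 fun i hi => absurd (hr i) hi.not_ge⟩ :
      (Icc 0 t ∩ G).Nonempty)
  refine ⟨s, hs, (hmem s).1 hsG, fun u hu => ?_⟩
  by_contra! hcon
  exact absurd (hmax ⟨⟨hs.1.trans hu.1.le, hu.2⟩, (hmem u).2 hcon⟩) hu.1.not_ge

namespace IsLevelStart

variable {J : Type*} [Fintype J] {r p : J → ℝ} {α : ℝ} {σ : ℝ → J → ℝ} {t x s : ℝ}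

lemma avail (h : IsALG r p α σ) (hs : IsLevelStart r p α σ t x s) {u : ℝ}
    (hu : u ∈ Ioc s t) : ∃ i, availAt r p σ u i :=
  let ⟨i, h1, h2, _⟩ := hs.exists_lt u hu
  ⟨i, (h.sched.availAt_iff u i).2 ⟨h1.le, h2⟩⟩

lemma optRem_lt_of_proc (h : IsALG r p α σ) (hinst : IsInstance r p α)
    (hs : IsLevelStart r p α σ t x s) {u : ℝ} (hu : u ∈ Ioc s t) {j : J} (hj : 0 < σ u j) :
    optRem p α σ j u < x := by
  obtain ⟨i, h1, h2, h3⟩ := hs.exists_lt u hu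
  exact ((h.of_proc hinst (hs.avail h hu) hj).1 i
    ((h.sched.availAt_iff u i).2 ⟨h1.le, h2⟩)).trans_lt h3

lemma workDone_le_of_release (h : IsALG r p α σ) (hinst : IsInstance r p α)
    (hs : IsLevelStart r p α σ t x s) (hx : 0 < x) {j : J} (hj : s ≤ r j) :
    workDone σ j t ≤ 1 / (1 - α) * x := by
  have h0 := hinst.alpha_mem.1
  have h1 : 0 < 1 - α := by linarith [hinst.alpha_mem.2]
  have hle : α * x / (1 - α) ≤ 1 / (1 - α) * x := by
    rw [div_mul_eq_mul_div]
    gcongr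
    linarith [hinst.alpha_mem.2]
  rcases le_or_gt (p j) (1 / (1 - α) * x) with hp | hp
  · exact (h.sched.workDone_le t j).trans hp
  refine le_trans ?_ hle
  refine h.sched.workDone_le_of_gap (b := p j - x) hs.mem.2 ?_ ?_ fun u hu hu1 hu2 hpos => ?_
  · rw [h.sched.workDone_eq_zero (hinst.r_nonneg j) hj]
    positivity
  · have : 1 / (1 - α) * x = α * x / (1 - α) + x := by field_simp; ring
    linarith
  · exact absurd (hs.optRem_lt_of_proc h hinst hu hpos)
      ((le_optRem_iff hinst.alpha_mem).2 ⟨hu1.le, hu2.le⟩).not_gt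

/-- A job released before the level start that is worked on afterwards has exactly `x` units of
work left at the level start, and has emitted by then. -/
lemma workDone_eq_of_carry (h : IsALG r p α σ) (hinst : IsInstance r p α)
    (hs : IsLevelStart r p α σ t x s) {c : J} (hc : r c < s)
    (hw : workDone σ c s < workDone σ c t) :
    workDone σ c s = p c - x ∧ α * p c ≤ workDone σ c s := by
  have h0 := hinst.alpha_mem.1
  have h1 : 0 < 1 - α := by linarith [hinst.alpha_mem.2]
  obtain ⟨h2, h3⟩ := (le_optRem_iff hinst.alpha_mem).1
    (hs.le_optRem c hc (hw.trans_le (h.sched.workDone_le t c)))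
  have h4 : workDone σ c s = p c - x := by
    refine le_antisymm h3 (le_of_not_gt fun hlt => hw.not_ge ?_)
    refine h.sched.workDone_le_of_gap hs.mem.2 le_rfl hlt fun u hu hu1 hu2 hpos => ?_
    exact absurd (hs.optRem_lt_of_proc h hinst hu hpos)
      ((le_optRem_iff hinst.alpha_mem).2 ⟨h2.trans hu1.le, hu2.le⟩).not_gt
  refine ⟨h4, ?_⟩
  rw [div_le_iff₀ h1] at h2
  have : x = p c - workDone σ c s := by linarith
  rw [this] at h2
  linarith

lemma workDone_lt_of_carry (h : IsALG r p α σ) (hinst : IsInstance r p α)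
    (hs : IsLevelStart r p α σ t x s) {c : J} (hc : r c < s)
    (hw : workDone σ c s < workDone σ c t) {u : ℝ} (hu : u ∈ Ioc s t) :
    workDone σ c s < workDone σ c u := by
  obtain ⟨hcx, hcα⟩ := hs.workDone_eq_of_carry h hinst hc hw
  by_contra! hcon
  have hcon : workDone σ c u = workDone σ c s :=
    le_antisymm hcon (h.sched.workDone_mono c hu.1.le)
  have hcl : IsCompact (Icc u t ∩ workDone σ c ⁻¹' {workDone σ c s}) :=
    isCompact_Icc.inter_right (isClosed_singleton.preimage (h.sched.workDone_continuous c))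
  obtain ⟨w, ⟨⟨hw1, hw2⟩, hmax⟩⟩ := hcl.exists_isGreatest ⟨u, left_mem_Icc.2 hu.2, hcon⟩
  have hw2 : workDone σ c w = workDone σ c s := hw2
  have hwt : w < t := lt_of_le_of_ne hw1.2 (by rintro rfl; exact hw.ne' hw2)
  obtain ⟨i, hi1, hi2, hi3⟩ := hs.exists_lt w ⟨hu.1.trans_le hw1.1, hw1.2⟩
  have hcw : optRem p α σ c w = x := by
    rw [optRem_of_ge hinst.alpha_mem (hw2 ▸ hcα), remT, hw2, hcx]
    ring
  have hev : ∀ᶠ v in nhds w, workDone σ i v < p i ∧ optRem p α σ i v < optRem p α σ c v :=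
    ((h.sched.workDone_continuous i).continuousAt.eventually_lt continuousAt_const hi2).and
      ((h.sched.optRem_continuous i).continuousAt.eventually_lt
        (h.sched.optRem_continuous c).continuousAt (hi3.trans_eq hcw.symm))
  obtain ⟨ε, hε, hball⟩ := Metric.eventually_nhds_iff.1 hev
  have hwm : w < min t (w + ε / 2) := lt_min hwt (by linarith)
  have hlt : workDone σ c w < workDone σ c (min t (w + ε / 2)) := by
    refine lt_of_le_of_ne (h.sched.workDone_mono c hwm.le) fun he => ?_
    exact absurd (hmax ⟨⟨hw1.1.trans hwm.le, min_le_left _ _⟩, he.symm.trans hw2⟩) hwm.not_ge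
  obtain ⟨v, hv, hpos⟩ := h.sched.exists_proc hwm.le hlt
  have hv2 := le_min_iff.1 hv.2
  obtain ⟨h5, h6⟩ := hball (y := v) (by
    rw [Real.dist_eq, abs_of_pos (sub_pos.2 hv.1)]
    linarith [hv2.2])
  have hvs : v ∈ Ioc s t := ⟨hu.1.trans (hw1.1.trans_lt hv.1), hv2.1⟩
  exact absurd ((h.of_proc hinst (hs.avail h hvs) hpos).1 i
    ((h.sched.availAt_iff v i).2 ⟨(hi1.trans hv.1).le, h5⟩)) h6.not_ge

/-- At most one job released before the level start is worked on afterwards. -/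
lemma eq_of_carry (h : IsALG r p α σ) (hinst : IsInstance r p α)
    (hs : IsLevelStart r p α σ t x s) (hx : 0 < x) {c d : J} (hc : r c < s) (hd : r d < s)
    (hcw : workDone σ c s < workDone σ c t) (hdw : workDone σ d s < workDone σ d t) :
    c = d := by
  by_contra hne
  obtain ⟨hcx, hcα⟩ := hs.workDone_eq_of_carry h hinst hc hcw
  obtain ⟨hdx, hdα⟩ := hs.workDone_eq_of_carry h hinst hd hdw
  have hst : s < t := lt_of_le_of_ne hs.mem.2 (by rintro rfl; exact hcw.false)
  obtain ⟨b, hb⟩ : ∃ b, (workDone σ c b < p c ∧ workDone σ d b < p d ∧ b < t) ∧ s < b := by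
    have hev : ∀ᶠ v in nhds s, workDone σ c v < p c ∧ workDone σ d v < p d ∧ v < t :=
      ((h.sched.workDone_continuous c).continuousAt.eventually_lt continuousAt_const
        (by linarith)).and
      (((h.sched.workDone_continuous d).continuousAt.eventually_lt continuousAt_const
        (by linarith)).and (eventually_lt_nhds hst))
    exact ((hev.filter_mono nhdsWithin_le_nhds).and
      (self_mem_nhdsWithin : Ioi s ∈ nhdsWithin s (Ioi s))).exists
  obtain ⟨⟨hbc, hbd, hbt⟩, hsb⟩ := hb
  have hmem : ∀ u ∈ Ioc s b, u ∈ Ioc s t := fun u hu => ⟨hu.1, hu.2.trans hbt.le⟩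
  have hrule : ∀ i k : J, r k < s → workDone σ k b < p k → α * p i ≤ workDone σ i s →
      α * p k ≤ workDone σ k s → ∀ u ∈ Ioc s b, 0 < σ u i → remT p σ i u ≤ remT p σ k u := by
    intro i k hk hkb hiα hkα u hu hpos
    have := (h.of_proc hinst (hs.avail h (hmem u hu)) hpos).1 k
      ((h.sched.availAt_iff u k).2 ⟨(hk.trans hu.1).le,
        (h.sched.workDone_mono k hu.2).trans_lt hkb⟩)
    rwa [optRem_of_ge hinst.alpha_mem (hiα.trans (h.sched.workDone_mono i hu.1.le)),
      optRem_of_ge hinst.alpha_mem (hkα.trans (h.sched.workDone_mono k hu.1.le))] at this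
  rcases h.sched.workDone_eq_or_eq_of_tie hsb
    (hrule c d hd hbd hcα hdα) (hrule d c hc hbc hdα hcα)
    (fun u hu hpos => (h.of_proc hinst (hs.avail h (hmem u hu)) hpos).2
      (hcα.trans_lt (hs.workDone_lt_of_carry h hinst hc hcw (hmem u hu))) d (Ne.symm hne))
    with ⟨u, hu, he⟩ | ⟨u, hu, he⟩
  · exact (hs.workDone_lt_of_carry h hinst hc hcw (hmem u hu)).ne' he
  · exact (hs.workDone_lt_of_carry h hinst hd hdw (hmem u hu)).ne' he

end IsLevelStart

section Volume

variable {J : Type*} [Fintype J] {r p : J → ℝ} {α : ℝ} {σ σO : ℝ → J → ℝ}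

open Finset in
/-- The volume of the jobs with optimistic remaining time below `x` that the schedule `σO` has
already completed is covered by the work done on the jobs still available under `σO`, up to the
remaining time `x` of at most one carried-over job. -/
lemma IsALG.volume_le (h : IsALG r p α σ) (hO : IsSchedule r p σO) (hinst : IsInstance r p α)
    {t x : ℝ} (ht : 0 ≤ t) (hx : 0 < x) :
    ∑ u ∈ {j | r j ≤ t ∧ workDone σ j t < p j ∧ workDone σO j t = p j} with
        optRem p α σ u t < x, remT p σ u t ≤
      (if ∀ j, p j < x then 0 else x) +
        ∑ i ∈ {j | r j ≤ t ∧ workDone σO j t < p j} with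
          workDone σ i t ≤ 1 / (1 - α) * x, workDone σ i t := by
  obtain ⟨s, hs⟩ := h.sched.exists_isLevelStart (α := α) hinst.r_nonneg ht x
  have hrem : ∀ j, 0 ≤ remT p σ j t := fun j => sub_nonneg.2 (h.sched.workDone_le t j)
  set V : Finset J := {j | s ≤ r j ∧ r j ≤ t} with hV
  set C : Finset J := {j | r j < s ∧ workDone σ j s < workDone σ j t} with hC
  have memV : ∀ j, j ∈ V ↔ s ≤ r j ∧ r j ≤ t := by simp [hV]
  have memC : ∀ j, j ∈ C ↔ r j < s ∧ workDone σ j s < workDone σ j t := by simp [hC]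
  have hbusy : ∑ j, (workDone σ j t - workDone σ j s) = t - s :=
    h.sched.sum_work_of_busy hs.mem.2 fun u hu => h.nonidling u (hs.avail h hu)
  have hsplit : ∑ j, (workDone σ j t - workDone σ j s) =
      ∑ j ∈ V, workDone σ j t + ∑ j ∈ C, (workDone σ j t - workDone σ j s) := by
    rw [hV, hC, sum_filter, sum_filter, ← sum_add_distrib]
    refine sum_congr rfl fun j _ => ?_
    rcases lt_or_ge (r j) s with h1 | h1
    · rw [if_neg (fun h2 => h2.1.not_gt h1)]
      split_ifs with h2
      · ring
      · have := h.sched.workDone_mono j hs.mem.2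
        have : ¬ workDone σ j s < workDone σ j t := fun h3 => h2 ⟨h1, h3⟩
        linarith
    · rw [if_neg (c := r j < s ∧ _) (fun h2 => h2.1.not_ge h1),
        h.sched.workDone_eq_zero (hinst.r_nonneg j) h1]
      split_ifs with h2
      · ring
      · have h3 : t ≤ r j := le_of_not_ge fun h3 => h2 ⟨h1, h3⟩
        rw [h.sched.workDone_eq_zero (hinst.r_nonneg j) h3]
        ring
  have hVO : ∑ j ∈ V, workDone σO j t ≤ t - s := by
    refine le_of_eq_of_le (sum_congr rfl fun j hj => ?_) (hO.sum_work_le V hs.mem.2)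
    rw [hO.workDone_eq_zero (hinst.r_nonneg j) ((memV j).1 hj).1, sub_zero]
  have hCx : ∑ j ∈ C, (workDone σ j t - workDone σ j s + remT p σ j t) ≤
      if ∀ j, p j < x then 0 else x := by
    have hcarry : ∀ j ∈ C, workDone σ j s = p j - x := fun j hj =>
      (hs.workDone_eq_of_carry h hinst ((memC j).1 hj).1 ((memC j).1 hj).2).1
    have hcard : C.card ≤ 1 := card_le_one.2 fun c hc d hd =>
      hs.eq_of_carry h hinst hx ((memC c).1 hc).1 ((memC d).1 hd).1
        ((memC c).1 hc).2 ((memC d).1 hd).2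
    have hsum : ∑ j ∈ C, (workDone σ j t - workDone σ j s + remT p σ j t) = C.card * x := by
      rw [← nsmul_eq_mul, ← sum_const]
      refine sum_congr rfl fun j hj => ?_
      rw [hcarry j hj, remT]
      ring
    rw [hsum]
    split_ifs with hpx
    · rcases C.eq_empty_or_nonempty with h1 | ⟨c, hc⟩
      · simp [h1]
      · have h1 := hcarry c hc
        have h2 := h.sched.workDone_nonneg (hinst.r_nonneg c) s
        linarith [hpx c]
    · have : (C.card : ℝ) ≤ 1 := by exact_mod_cast hcard
      nlinarith
  have hVsplit : ∀ f : J → ℝ, ∑ j ∈ V, f j =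
      ∑ j ∈ V with workDone σO j t = p j, f j + ∑ j ∈ V with ¬ workDone σO j t = p j, f j :=
    fun f => (sum_filter_add_sum_filter_not V _ f).symm
  have hVC : ∑ j ∈ V with workDone σO j t = p j, remT p σ j t ≤
      ∑ j ∈ C, (workDone σ j t - workDone σ j s) +
        ∑ j ∈ V with ¬ workDone σO j t = p j, workDone σ j t := by
    have h1 : ∑ j ∈ V with workDone σO j t = p j, remT p σ j t =
        ∑ j ∈ V with workDone σO j t = p j, workDone σO j t -
          ∑ j ∈ V with workDone σO j t = p j, workDone σ j t := by
      rw [← sum_sub_distrib]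
      exact sum_congr rfl fun j hj => by rw [remT, (mem_filter.1 hj).2]
    have h2 := hVsplit fun j => workDone σO j t
    have h3 := hVsplit fun j => workDone σ j t
    have h4 : 0 ≤ ∑ j ∈ V with ¬ workDone σO j t = p j, workDone σO j t :=
      sum_nonneg fun j _ => hO.workDone_nonneg (hinst.r_nonneg j) t
    linarith
  have hD : ∑ j ∈ V with ¬ workDone σO j t = p j, workDone σ j t ≤
      ∑ i ∈ {j | r j ≤ t ∧ workDone σO j t < p j} with
        workDone σ i t ≤ 1 / (1 - α) * x, workDone σ i t := by
    refine sum_le_sum_of_subset_of_nonneg (fun j hj => ?_)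
      fun j _ _ => h.sched.workDone_nonneg (hinst.r_nonneg j) t
    obtain ⟨h1, h2⟩ := mem_filter.1 hj
    obtain ⟨h3, h4⟩ := (memV j).1 h1
    simp only [mem_filter, Finset.mem_univ, true_and]
    exact ⟨⟨h4, lt_of_le_of_ne (hO.workDone_le t j) h2⟩,
      hs.workDone_le_of_release h hinst hx h3⟩
  have hS : ∑ u ∈ {j | r j ≤ t ∧ workDone σ j t < p j ∧ workDone σO j t = p j} with
        optRem p α σ u t < x, remT p σ u t ≤
      ∑ j ∈ V with workDone σO j t = p j, remT p σ j t + ∑ j ∈ C, remT p σ j t := by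
    have hdisj : Disjoint (V.filter fun j => workDone σO j t = p j) C := by
      refine disjoint_left.2 fun j hj hj' => ?_
      exact ((memV j).1 (mem_filter.1 hj).1).1.not_gt ((memC j).1 hj').1
    rw [← sum_union hdisj]
    refine sum_le_sum_of_subset_of_nonneg (fun j hj => ?_) fun j _ _ => hrem j
    simp only [mem_filter, Finset.mem_univ, true_and] at hj
    obtain ⟨⟨h1, h2, h3⟩, h4⟩ := hj
    rw [Finset.mem_union, mem_filter, memV, memC]
    rcases lt_or_ge (r j) s with h5 | h5
    · have h6 := h.sched.workDone_mono j hs.mem.2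
      refine Or.inr ⟨h5, lt_of_le_of_ne h6 fun he => ?_⟩
      have h7 := hs.le_optRem j h5 (h6.trans_lt h2)
      rw [optRem, remT, he] at h7
      exact h4.not_ge h7
    · exact Or.inl ⟨⟨h5, h1⟩, h3⟩
  rw [sum_add_distrib] at hCx
  linarith

open Finset in
/-- Local competitiveness: at any time, the number of available jobs under the algorithm is
bounded in terms of the number of available jobs under any other schedule. -/
lemma IsALG.card_avail_le (h : IsALG r p α σ) (hO : IsSchedule r p σO)
    (hinst : IsInstance r p α) {n : ℕ} (hn : 1 / (1 - α) = (n : ℝ)) (t : ℝ) :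
    #{j | r j ≤ t ∧ workDone σ j t < p j} ≤
      (n + 2) * #{j | r j ≤ t ∧ workDone σO j t < p j} := by
  rcases lt_or_ge t 0 with ht | ht
  · rw [filter_false_of_mem fun j _ hj => by linarith [hj.1, hinst.r_nonneg j]]
    simp
  have hn0 : 0 < n := by
    have : (0 : ℝ) < n := hn ▸ one_div_pos.2 (by linarith [hinst.alpha_mem.2])
    exact_mod_cast this
  have hβ : 0 < (1 - α) / α := div_pos (by linarith [hinst.alpha_mem.2]) hinst.alpha_mem.1
  set A : Finset J := {j | r j ≤ t ∧ workDone σ j t < p j ∧ workDone σO j t = p j} with hA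
  set D : Finset J := {j | r j ≤ t ∧ workDone σO j t < p j} with hD
  have hvol := fun x hx => h.volume_le hO hinst (x := x) ht hx
  rw [← hA, ← hD] at hvol
  have hq : ∀ u ∈ A, 0 < remT p σ u t := fun u hu => sub_pos.2 (mem_filter.1 hu).2.2.1
  have hsub : ({j | r j ≤ t ∧ workDone σ j t < p j} : Finset J) ⊆ A ∪ D := by
    intro j hj
    simp only [mem_filter, Finset.mem_univ, true_and, Finset.mem_union, hA, hD] at hj ⊢
    rcases (hO.workDone_le t j).lt_or_eq with h1 | h1
    · exact Or.inr ⟨hj.1, h1⟩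
    · exact Or.inl ⟨hj.1, hj.2, h1⟩
  have hcard : #A ≤ n * #D + 1 := by
    refine card_le_of_volume_le (z := fun u => optRem p α σ u t) (q := fun u => remT p σ u t)
      (y := fun u => workDone σ u t) hn0 (fun u hu => ?_) (fun u _ => optRem_le_remT u t) hq
      (fun i _ => h.sched.workDone_nonneg (hinst.r_nonneg i) t) fun x hx => ?_
    · exact le_min (mul_nonneg hβ.le (h.sched.workDone_nonneg (hinst.r_nonneg u) t)) (hq u hu).le
    · have h1 := hvol x hx
      rw [hn] at h1
      refine h1.trans (add_le_add ?_ le_rfl)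
      split_ifs
      exacts [hx.le, le_rfl]
  have htot := (Finset.card_le_card hsub).trans (card_union_le A D)
  rcases D.eq_empty_or_nonempty with hD0 | hD0
  · have hA0 : A = ∅ := by
      by_contra hne
      have hsum : ∀ j, p j < 1 + ∑ i, p i := fun j => by
        have := single_le_sum (f := p) (fun i _ => (hinst.p_pos i).le) (Finset.mem_univ j)
        linarith
      have h1 := hvol (1 + ∑ i, p i)
        (by linarith [sum_nonneg fun i (_ : i ∈ Finset.univ) => (hinst.p_pos i).le])
      rw [if_pos hsum, hD0, filter_empty, sum_empty, add_zero,
        filter_true_of_mem fun u hu => ?_] at h1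
      · exact absurd h1 (sum_pos hq (nonempty_iff_ne_empty.2 hne)).not_ge
      · have := h.sched.workDone_nonneg (hinst.r_nonneg u) t
        refine (optRem_le_remT u t).trans_lt ((sub_le_self _ this).trans_lt (hsum u))
    simpa [hA0, hD0] using htot
  · have := hD0.card_pos
    nlinarith

/-- The total flow time is the integral of the number of available jobs. -/
lemma IsSchedule.integral_card_avail (h : IsSchedule r p σ) (hr : ∀ j, 0 ≤ r j)
    (hp : ∀ j, 0 < p j) (hfin : ∀ j, cTime p σ j ≠ ⊤) :
    Integrable (fun t : ℝ =>
        ((Finset.univ.filter fun j => r j ≤ t ∧ workDone σ j t < p j).card : ℝ)) ∧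
      ∫ t, ((Finset.univ.filter fun j => r j ≤ t ∧ workDone σ j t < p j).card : ℝ) =
        ∑ j, ((cTime p σ j).toReal - r j) := by
  have hfun : (fun t : ℝ =>
      ((Finset.univ.filter fun j => r j ≤ t ∧ workDone σ j t < p j).card : ℝ)) =
      fun t => ∑ j, indicator (Ico (r j) (cTime p σ j).toReal) (fun _ => (1 : ℝ)) t := by
    funext t
    rw [Finset.card_filter]
    push_cast
    refine Finset.sum_congr rfl fun j _ => ?_
    simp only [indicator_apply, mem_Ico, h.lt_toReal_cTime_iff (hr j) (hp j) (hfin j)]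
  have hint : ∀ j, Integrable
      (indicator (Ico (r j) (cTime p σ j).toReal) fun _ : ℝ => (1 : ℝ)) := fun j =>
    (integrable_indicator_iff measurableSet_Ico).2 (by simp)
  have hle : ∀ j, r j ≤ (cTime p σ j).toReal := fun j =>
    ((h.lt_toReal_cTime_iff (hr j) (hp j) (hfin j) (r j)).2
      (by rw [h.workDone_eq_zero (hr j) le_rfl]; exact hp j)).le
  rw [hfun]
  refine ⟨integrable_finsetSum _ fun j _ => hint j, ?_⟩
  rw [integral_finsetSum _ fun j _ => hint j]
  refine Finset.sum_congr rfl fun j _ => ?_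
  rw [integral_indicator measurableSet_Ico]
  simp [hle j]

end Volume

/-- **Main theorem.** If `σ` is an ALG-schedule, `σO` any
schedule of the same instance, `1/(1-α)` is an integer, and every job completes
under both schedules, then the total flow time of `σ` is at most
`4 + 2/(1-α)` times that of `σO`. -/
theorem stmt10 {J : Type*} [Fintype J] {r p : J → ℝ} {α : ℝ} {σ σO : ℝ → J → ℝ}
    (hinst : IsInstance r p α) (hint : ∃ n : ℕ, 1 / (1 - α) = (n : ℝ))
    (halg : IsALG r p α σ) (hO : IsSchedule r p σO)
    (hfin : ∀ j, cTime p σ j ≠ ⊤) (hfinO : ∀ j, cTime p σO j ≠ ⊤) :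
    ∑ j, ((cTime p σ j).toReal - r j)
      ≤ (4 + 2 / (1 - α)) * ∑ j, ((cTime p σO j).toReal - r j) := by
  obtain ⟨n, hn⟩ := hint
  obtain ⟨hA, hA'⟩ := halg.sched.integral_card_avail hinst.r_nonneg hinst.p_pos hfin
  obtain ⟨hB, hB'⟩ := hO.integral_card_avail hinst.r_nonneg hinst.p_pos hfinO
  have h2n : 2 / (1 - α) = 2 * (n : ℝ) := by rw [← hn]; ring
  rw [← hA', ← hB', h2n, ← integral_const_mul]
  refine integral_mono hA (hB.const_mul _) fun t => ?_
  have h1 := halg.card_avail_le hO hinst hn t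
  have h2 : (_ : ℝ) ≤ _ := Nat.cast_le.2 h1
  push_cast at h2
  refine h2.trans (mul_le_mul_of_nonneg_right ?_ (Nat.cast_nonneg _))
  linarith [(Nat.cast_nonneg n : (0 : ℝ) ≤ n)]
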